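/- The maximal finite-horizon reach probability equals the value of the backward recursion: for every initial state s_0 ∈ S, max over all Markov policies μ = (μ_0, …, μ_{N-1}) of r_N(s_0, μ) equals V_0(s_0), where V_N(s) = 1_G(s) and for 1 ≤ t ≤ N, V_{t-1}(s) = 1_G(s) + 1_{S∖G}(s) · max_{u ∈ U} ∑_{s' ∈ S} V_t(s') τ(s' | s, u). Moreover, any policy choosing at each time t and each state s ∉ G a maximizing action u in this recursion attains the maximum. -/

import Mathlib

/-- Probability weight of the trajectory tail `[s_1, …, s_n]` starting from state `s` at
time `t` under Markov policy `μ` and kernel `τ` (where `τ s' s u` is τ(s' | s, u)):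
∏_{k} τ(s_{k+1} | s_k, μ_{t+k}(s_k)). -/
def trajW {S U : Type} (τ : S → S → U → ℝ) (μ : ℕ → S → U) : ℕ → S → List S → ℝ
  | _, _, [] => 1
  | t, s, s' :: rest => τ s' s (μ t s) * trajW τ μ (t + 1) s' rest

/-- Reach probability r_N(s_0, μ): the probability, under the trajectory measure induced
by the Markov policy μ and initial state s_0, that s_t ∈ G for some t ∈ {0, …, N}. -/
noncomputable def reachProb {S U : Type} [Fintype S] [DecidableEq S]
    (G : Finset S) (τ : S → S → U → ℝ) (μ : ℕ → S → U) (N : ℕ) (s0 : S) : ℝ :=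
  ∑ p : Fin N → S,
    if s0 ∈ G ∨ ∃ i : Fin N, p i ∈ G then trajW τ μ 0 s0 (List.ofFn p) else 0

/-- Probability of visiting `G` within `n` steps when the chain is in state `s` at time `t`. -/
noncomputable def reachProbFrom {S U : Type} [Fintype S] [DecidableEq S]
    (G : Finset S) (τ : S → S → U → ℝ) (μ : ℕ → S → U) (t n : ℕ) (s : S) : ℝ :=
  ∑ p : Fin n → S, if s ∈ G ∨ ∃ i : Fin n, p i ∈ G then trajW τ μ t s (List.ofFn p) else 0

theorem Fin.sum_univ_cons {S : Type} [Fintype S] {n : ℕ} (f : (Fin (n + 1) → S) → ℝ) :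
    ∑ p : Fin (n + 1) → S, f p = ∑ s' : S, ∑ q : Fin n → S, f (Fin.cons s' q) := by
  rw [← (Fin.consEquiv fun _ => S).sum_comp, Fintype.sum_prod_type]
  rfl

theorem sum_trajW {S U : Type} [Fintype S] (τ : S → S → U → ℝ)
    (hτ_sum : ∀ s u, ∑ s' : S, τ s' s u = 1) (μ : ℕ → S → U) (t n : ℕ) (s : S) :
    ∑ p : Fin n → S, trajW τ μ t s (List.ofFn p) = 1 := by
  induction n generalizing t s with
  | zero => simp [trajW]
  | succ n ih =>
    simp only [Fin.sum_univ_cons, List.ofFn_cons, trajW, ← Finset.mul_sum, ih, mul_one, hτ_sum]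

theorem reachProbFrom_of_mem {S U : Type} [Fintype S] [DecidableEq S] (τ : S → S → U → ℝ)
    (hτ_sum : ∀ s u, ∑ s' : S, τ s' s u = 1) {G : Finset S} (μ : ℕ → S → U) (t n : ℕ) {s : S}
    (hs : s ∈ G) : reachProbFrom G τ μ t n s = 1 := by
  simp [reachProbFrom, hs, sum_trajW τ hτ_sum]

theorem reachProbFrom_zero_of_notMem {S U : Type} [Fintype S] [DecidableEq S]
    (τ : S → S → U → ℝ) {G : Finset S} (μ : ℕ → S → U) (t : ℕ) {s : S} (hs : s ∉ G) :
    reachProbFrom G τ μ t 0 s = 0 := by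
  simp [reachProbFrom, hs]

theorem reachProbFrom_succ_of_notMem {S U : Type} [Fintype S] [DecidableEq S]
    (τ : S → S → U → ℝ) {G : Finset S} (μ : ℕ → S → U) (t n : ℕ) {s : S} (hs : s ∉ G) :
    reachProbFrom G τ μ t (n + 1) s =
      ∑ s' : S, reachProbFrom G τ μ (t + 1) n s' * τ s' s (μ t s) := by
  simp only [reachProbFrom, Fin.sum_univ_cons, List.ofFn_cons, trajW, hs, false_or,
    Fin.exists_fin_succ, Fin.cons_zero, Fin.cons_succ, Finset.sum_mul, ite_mul, zero_mul,
    mul_comm (τ _ _ _)]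

/- STATEMENT 8: in a finite MDP, the maximal finite-horizon reach probability equals the
value of the backward recursion: for every s_0, max_μ r_N(s_0, μ) = V_0(s_0); moreover any
policy choosing, at each time t and state s ∉ G, a maximizing action in the recursion
attains the maximum. -/
theorem reach_probability_eq_DP_value
    {S U : Type} [Fintype S] [DecidableEq S] [Nonempty S] [Fintype U] [Nonempty U]
    -- stochastic transition kernel
    (τ : S → S → U → ℝ)
    (hτ_nonneg : ∀ s u s', 0 ≤ τ s' s u)
    (hτ_sum : ∀ s u, ∑ s' : S, τ s' s u = 1)
    -- target set, horizon, and the backward recursion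
    (G : Finset S) (N : ℕ)
    (V : ℕ → S → ℝ)
    (hVN : ∀ s, V N s = if s ∈ G then 1 else 0)
    (hVrec : ∀ t, 1 ≤ t → t ≤ N → ∀ s,
      V (t - 1) s = (if s ∈ G then (1 : ℝ) else 0) +
        (if s ∈ G then (0 : ℝ) else 1) *
          Finset.univ.sup' Finset.univ_nonempty (fun u : U => ∑ s' : S, V t s' * τ s' s u))
    (s0 : S) :
    -- V_0(s_0) is an upper bound on the reach probability over all Markov policies,
    (∀ μ : ℕ → S → U, reachProb G τ μ N s0 ≤ V 0 s0) ∧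
    -- the maximum is attained,
    (∃ μ : ℕ → S → U, reachProb G τ μ N s0 = V 0 s0) ∧
    -- and any policy choosing maximizing actions at states outside G attains it
    (∀ μ : ℕ → S → U,
      (∀ t, t < N → ∀ s, s ∉ G →
        (∑ s' : S, V (t + 1) s' * τ s' s (μ t s)) =
          Finset.univ.sup' Finset.univ_nonempty
            (fun u : U => ∑ s' : S, V (t + 1) s' * τ s' s u)) →
      reachProb G τ μ N s0 = V 0 s0) := by
  have hV_mem : ∀ t, t ≤ N → ∀ s ∈ G, V t s = 1 := by
    intro t ht s hs
    obtain rfl | h := ht.eq_or_lt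
    · simp [hVN, hs]
    · simpa [hs] using hVrec (t + 1) (by omega) h s
  have hV_notMem : ∀ t, t < N → ∀ s, s ∉ G → V t s = Finset.univ.sup' Finset.univ_nonempty
      (fun u : U => ∑ s' : S, V (t + 1) s' * τ s' s u) := by
    intro t ht s hs
    simpa [hs] using hVrec (t + 1) (by omega) ht s
  have upper : ∀ (μ : ℕ → S → U) (n t : ℕ), t + n = N → ∀ s,
      reachProbFrom G τ μ t n s ≤ V t s := by
    intro μ n
    induction n with
    | zero =>
      rintro t rfl s
      by_cases hs : s ∈ G
      · rw [reachProbFrom_of_mem τ hτ_sum μ t 0 hs, hV_mem t le_rfl s hs]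
      · rw [reachProbFrom_zero_of_notMem τ μ t hs]
        simpa [hs] using (hVN s).ge
    | succ n ih =>
      intro t ht s
      by_cases hs : s ∈ G
      · rw [reachProbFrom_of_mem τ hτ_sum μ t _ hs, hV_mem t (by omega) s hs]
      · rw [reachProbFrom_succ_of_notMem τ μ t n hs, hV_notMem t (by omega) s hs]
        refine le_trans (Finset.sum_le_sum fun s' _ => mul_le_mul_of_nonneg_right
          (ih (t + 1) (by omega) s') (hτ_nonneg s (μ t s) s')) ?_
        exact Finset.le_sup' (fun u : U => ∑ s' : S, V (t + 1) s' * τ s' s u)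
          (Finset.mem_univ (μ t s))
  have attained : ∀ μ : ℕ → S → U,
      (∀ t, t < N → ∀ s, s ∉ G →
        (∑ s' : S, V (t + 1) s' * τ s' s (μ t s)) =
          Finset.univ.sup' Finset.univ_nonempty
            (fun u : U => ∑ s' : S, V (t + 1) s' * τ s' s u)) →
      ∀ n t : ℕ, t + n = N → ∀ s, reachProbFrom G τ μ t n s = V t s := by
    intro μ hμ n
    induction n with
    | zero =>
      rintro t rfl s
      by_cases hs : s ∈ G
      · rw [reachProbFrom_of_mem τ hτ_sum μ t 0 hs, hV_mem t le_rfl s hs]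
      · rw [reachProbFrom_zero_of_notMem τ μ t hs]
        simpa [hs] using (hVN s).symm
    | succ n ih =>
      intro t ht s
      by_cases hs : s ∈ G
      · rw [reachProbFrom_of_mem τ hτ_sum μ t _ hs, hV_mem t (by omega) s hs]
      · rw [reachProbFrom_succ_of_notMem τ μ t n hs, hV_notMem t (by omega) s hs,
          ← hμ t (by omega) s hs]
        simp only [ih (t + 1) (by omega)]
  refine ⟨fun μ => upper μ N 0 (zero_add N) s0, ?_,
    fun μ hμ => attained μ hμ N 0 (zero_add N) s0⟩
  choose μ hμ using fun (t : ℕ) (s : S) => Finset.exists_mem_eq_sup' Finset.univ_nonempty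
    (fun u : U => ∑ s' : S, V (t + 1) s' * τ s' s u)
  exact ⟨μ, attained μ (fun t _ s _ => (hμ t s).2.symm) N 0 (zero_add N) s0⟩
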